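/- Let a be a non-negative integer, b a positive integer, and s₁,…,s_a,s ∈ ℂ with Re(s) > b and Re(s+s_{a−k+1}+⋯+s_a) > k+b for k = 1,…,a. Then all series occurring in the recursive definition of G_q^{(a,b)}(s₁,…,s_a;s) converge absolutely, and G_q^{(a,b)}(s₁,…,s_a;s) = Σ_{0<m₁<⋯<m_a<m} ( q^{(s₁−1)m₁+⋯+(s_a−1)m_a+(s−b)m} / ([m₁]_q^{s₁}⋯[m_a]_q^{s_a}[m]_q^{s−b+1}) ) · Σ_{m−m_a≤x₁≤⋯≤x_{b−1}≤m} q^{x₁+⋯+x_{b−1}}/([x₁]_q⋯[x_{b−1}]_q), where the x_i range over integers, for a = 0 the inner constraint reads m ≤ x₁ ≤ ⋯ ≤ x_{b−1} ≤ m (so all x_i = m), and for b = 1 the inner sum is empty and equal to 1. -/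

import Mathlib

open Complex

/-- The `q`-analogue `[n]_q = (1 - q^n)/(1 - q)` of a natural number `n`. -/
noncomputable def qnum (q : ℝ) (n : ℕ) : ℝ := (1 - q ^ n) / (1 - q)

/-- The general term `∏_j q^{(s_j−1)n_j}/[n_j]_q^{s_j}` of the `q`-multiple zeta series. -/
noncomputable def zetaTerm (q : ℝ) {r : ℕ} (s : Fin r → ℂ) (n : Fin r → ℕ) : ℂ :=
  ∏ j, (q : ℂ) ^ ((s j - 1) * (n j : ℂ)) / ((qnum q (n j) : ℂ) ^ (s j))

/-- Strictly increasing `r`-tuples of positive integers `0 < n₁ < ⋯ < n_r`. -/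
def qIdx (r : ℕ) : Type := {n : Fin r → ℕ // StrictMono n ∧ ∀ j, 0 < n j}

/-- The `q`-multiple zeta function of depth `r`, given by its series. -/
noncomputable def qMZF (q : ℝ) {r : ℕ} (s : Fin r → ℂ) : ℂ :=
  ∑' n : qIdx r, zetaTerm q s n.1

/-- `Gq q b a sv s` is the function `G_q^{(a,b)}(s₁,…,s_a; s)`. -/
noncomputable def Gq (q : ℝ) : (b : ℕ) → (a : ℕ) → (Fin a → ℂ) → ℂ → ℂ
  | 0, _, _, _ => 0
  | 1, _a, sv, s => qMZF q (Fin.snoc sv s)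
  | (b + 2), a, sv, s =>
      (∑' n : ℕ, Gq q (b + 1) (a + 1)
          (Fin.snoc sv (s - (n : ℂ) - ((b : ℂ) + 2))) ((n : ℂ) + ((b : ℂ) + 2))) -
      ∑' n : ℕ, Gq q (b + 1) (a + 1) (Fin.snoc sv (-(n : ℂ))) (s + (n : ℂ))

/-- The assertion that all series occurring in the recursive definition of
`G_q^{(a,b)}(s₁,…,s_a;s)` converge (absolutely). -/
def GqSummable (q : ℝ) : (b : ℕ) → (a : ℕ) → (Fin a → ℂ) → ℂ → Prop
  | 0, _, _, _ => True
  | 1, a, sv, s => Summable (fun n : qIdx (a + 1) => zetaTerm q (Fin.snoc sv s) n.1)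
  | (b + 2), a, sv, s =>
      (∀ n : ℕ, GqSummable q (b + 1) (a + 1)
          (Fin.snoc sv (s - (n : ℂ) - ((b : ℂ) + 2))) ((n : ℂ) + ((b : ℂ) + 2))) ∧
      (∀ n : ℕ, GqSummable q (b + 1) (a + 1) (Fin.snoc sv (-(n : ℂ))) (s + (n : ℂ))) ∧
      Summable (fun n : ℕ => Gq q (b + 1) (a + 1)
          (Fin.snoc sv (s - (n : ℂ) - ((b : ℂ) + 2))) ((n : ℂ) + ((b : ℂ) + 2))) ∧
      Summable (fun n : ℕ => Gq q (b + 1) (a + 1) (Fin.snoc sv (-(n : ℂ))) (s + (n : ℂ)))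

/-- The index set for the series representation of `G_q^{(a,b)}`: tuples
`0 < m₁ < ⋯ < m_a < m` together with chains `m − m_a ≤ x₁ ≤ ⋯ ≤ x_{b−1} ≤ m`
(with the lower bound understood as `m − m_a = m` when `a = 0`). -/
def GIdx (a b : ℕ) : Type :=
  {p : (Fin a → ℕ) × ℕ × (Fin (b - 1) → ℕ) //
    StrictMono p.1 ∧ (∀ j, 0 < p.1 j) ∧ 0 < p.2.1 ∧ (∀ j, p.1 j < p.2.1) ∧
    Monotone p.2.2 ∧
    (∀ i, p.2.1 - (if h : 0 < a then p.1 ⟨a - 1, by omega⟩ else 0) ≤ p.2.2 i ∧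
      p.2.2 i ≤ p.2.1)}

/-- The general term of the series representation of `G_q^{(a,b)}`. -/
noncomputable def GqRepTerm (q : ℝ) {a b : ℕ} (sv : Fin a → ℂ) (s : ℂ)
    (p : (Fin a → ℕ) × ℕ × (Fin (b - 1) → ℕ)) : ℂ :=
  (∏ j, (q : ℂ) ^ ((sv j - 1) * (p.1 j : ℂ)) / (qnum q (p.1 j) : ℂ) ^ (sv j)) *
    ((q : ℂ) ^ ((s - (b : ℂ)) * (p.2.1 : ℂ)) / (qnum q p.2.1 : ℂ) ^ (s - (b : ℂ) + 1)) *
    ∏ i, ((q : ℂ) ^ (p.2.2 i) / (qnum q (p.2.2 i) : ℂ))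

/-- The weight `q^n / [n]_q`. -/
noncomputable def qweight (q : ℝ) (n : ℕ) : ℝ := q ^ n / qnum q n

/-- The sum of `∏ q^{x_i}/[x_i]_q` over chains `lo ≤ x₁ ≤ ⋯ ≤ x_c ≤ hi`. -/
noncomputable def chainSum (q : ℝ) : ℕ → ℕ → ℕ → ℝ
  | 0, _, _ => 1
  | c + 1, lo, hi => ∑ k ∈ Finset.Icc lo hi, qweight q k * chainSum q c k hi

open Classical in
/-- The finite set of chains `lo ≤ x₁ ≤ ⋯ ≤ x_c ≤ hi`. -/
noncomputable def chains (c lo hi : ℕ) : Finset (Fin c → ℕ) :=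
  (Fintype.piFinset fun _ => Finset.Icc lo hi).filter Monotone

theorem mem_chains {c lo hi : ℕ} {x : Fin c → ℕ} :
    x ∈ chains c lo hi ↔ Monotone x ∧ ∀ i, lo ≤ x i ∧ x i ≤ hi := by
  simp [chains, and_comm]

theorem monotone_cons_iff {c : ℕ} {k : ℕ} {x : Fin c → ℕ} :
    Monotone (Fin.cons k x : Fin (c + 1) → ℕ) ↔ (∀ i, k ≤ x i) ∧ Monotone x := by
  constructor
  · intro h
    refine ⟨fun i => by simpa using h (Fin.zero_le i.succ), fun i j hij => ?_⟩
    simpa using h (Fin.succ_le_succ_iff.2 hij)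
  · rintro ⟨h1, h2⟩ i j hij
    induction i using Fin.cases with
    | zero =>
      induction j using Fin.cases with
      | zero => simp
      | succ j => simpa using h1 j
    | succ i =>
      induction j using Fin.cases with
      | zero => simp at hij
      | succ j => simpa using h2 (Fin.succ_le_succ_iff.1 hij)

theorem sum_chains_eq_chainSum (q : ℝ) (c lo hi : ℕ) :
    ∑ x ∈ chains c lo hi, ∏ i, qweight q (x i) = chainSum q c lo hi := by
  induction c generalizing lo with
  | zero =>
    have : chains 0 lo hi = Finset.univ := by
      ext x
      simp [mem_chains, Subsingleton.monotone, -Finset.univ_unique]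
    simp [this, chainSum]
  | succ c ih =>
    simp only [chainSum, ← ih, Finset.mul_sum]
    rw [Finset.sum_sigma']
    refine Finset.sum_nbij' (fun x => ⟨x 0, Fin.tail x⟩) (fun p => Fin.cons p.1 p.2) ?_ ?_ ?_ ?_ ?_
    · intro x hx
      rw [mem_chains] at hx
      obtain ⟨h1, h2⟩ := hx
      rw [← Fin.cons_self_tail x, monotone_cons_iff] at h1
      simp only [Finset.mem_sigma, Finset.mem_Icc, mem_chains]
      exact ⟨h2 0, h1.2, fun i => ⟨h1.1 i, (h2 i.succ).2⟩⟩
    · rintro ⟨k, x⟩ hx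
      simp only [Finset.mem_sigma, Finset.mem_Icc, mem_chains] at hx
      rw [mem_chains, monotone_cons_iff]
      refine ⟨⟨fun i => (hx.2.2 i).1, hx.2.1⟩, fun i => ?_⟩
      induction i using Fin.cases with
      | zero => simpa using hx.1
      | succ i => simpa using ⟨hx.1.1.trans (hx.2.2 i).1, (hx.2.2 i).2⟩
    · intro x _
      simp
    · rintro ⟨k, x⟩ _
      simp
    · intro x _
      simp [Fin.prod_univ_succ, Fin.tail]

theorem chainSum_succ_of_lt (q : ℝ) (c : ℕ) {lo hi : ℕ} (h : hi < lo) :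
    chainSum q (c + 1) lo hi = 0 := by
  simp [chainSum, h]

theorem chainSum_succ_left (q : ℝ) (c : ℕ) {lo hi : ℕ} (h : lo ≤ hi) :
    chainSum q (c + 1) lo hi =
      qweight q lo * chainSum q c lo hi + chainSum q (c + 1) (lo + 1) hi := by
  simp only [chainSum]
  rw [← Finset.insert_Icc_succ_left_eq_Icc h, Finset.sum_insert (by simp)]
  rfl

theorem chainSum_succ_right (q : ℝ) (c : ℕ) {lo hi : ℕ} (h : lo ≤ hi + 1) :
    chainSum q (c + 1) lo (hi + 1) =
      chainSum q (c + 1) lo hi + qweight q (hi + 1) * chainSum q c lo (hi + 1) := by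
  induction c generalizing lo with
  | zero => simp [chainSum, Finset.sum_Icc_succ_top h]
  | succ c ih =>
    rw [chainSum, Finset.sum_congr rfl fun k hk => by rw [ih (Finset.mem_Icc.1 hk).2]]
    simp only [mul_add, Finset.sum_add_distrib]
    rw [Finset.sum_Icc_succ_top h, chainSum_succ_of_lt q c (Nat.lt_succ_self hi)]
    simp only [mul_zero, add_zero, chainSum, Finset.mul_sum]
    congr 1
    exact Finset.sum_congr rfl fun k _ => by ring

theorem sum_Ico_qweight_mul_chainSum (q : ℝ) (c : ℕ) {g hi : ℕ} (hg : 1 ≤ g) (h : g ≤ hi) :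
    ∑ j ∈ Finset.Ico 1 g, qweight q j * chainSum q c j hi =
      chainSum q (c + 1) 1 hi - chainSum q (c + 1) g hi := by
  have h1 := Finset.sum_Ico_consecutive (fun j => qweight q j * chainSum q c j hi) hg
    (h.trans hi.le_succ)
  simp only [chainSum]
  rw [eq_sub_iff_add_eq]
  exact h1

section Bounds

variable {q : ℝ} (hq0 : 0 < q) (hq1 : q < 1)

include hq0 hq1

theorem one_le_qnum {n : ℕ} (hn : 0 < n) : 1 ≤ qnum q n := by
  rw [qnum, le_div_iff₀ (by linarith)]
  have : q ^ n ≤ q ^ 1 := pow_le_pow_of_le_one hq0.le hq1.le hn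
  linarith [pow_one q]

theorem qnum_le (n : ℕ) : qnum q n ≤ (1 - q)⁻¹ := by
  rw [qnum, div_eq_mul_inv]
  have h1 : 0 < (1 - q)⁻¹ := inv_pos.2 (by linarith)
  have : 0 < q ^ n := pow_pos hq0 n
  nlinarith

theorem qweight_nonneg (n : ℕ) : 0 ≤ qweight q n := by
  have : q ^ n ≤ 1 := pow_le_one₀ hq0.le hq1.le
  exact div_nonneg (by positivity) (div_nonneg (by linarith) (by linarith))

theorem qweight_le (n : ℕ) : qweight q n ≤ q ^ n := by
  rcases Nat.eq_zero_or_pos n with rfl | hn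
  · simp [qweight, qnum]
  · exact div_le_self (by positivity) (one_le_qnum hq0 hq1 hn)

theorem sum_Icc_qweight_le (lo hi : ℕ) :
    ∑ k ∈ Finset.Icc lo hi, qweight q k ≤ q ^ lo * (1 - q)⁻¹ := by
  calc ∑ k ∈ Finset.Icc lo hi, qweight q k ≤ ∑ k ∈ Finset.Icc lo hi, q ^ k :=
        Finset.sum_le_sum fun k _ => qweight_le hq0 hq1 k
    _ = ∑ k ∈ Finset.Ico lo (hi + 1), q ^ k := rfl
    _ = ∑ i ∈ Finset.range (hi + 1 - lo), q ^ lo * q ^ i := by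
        rw [Finset.sum_Ico_eq_sum_range]
        simp only [pow_add]
    _ = q ^ lo * ∑ i ∈ Finset.range (hi + 1 - lo), q ^ i := by rw [Finset.mul_sum]
    _ ≤ q ^ lo * (1 - q)⁻¹ := by
        gcongr
        rw [← tsum_geometric_of_lt_one hq0.le hq1]
        exact (summable_geometric_of_lt_one hq0.le hq1).sum_le_tsum _ fun _ _ => by positivity

theorem chainSum_nonneg (c lo hi : ℕ) : 0 ≤ chainSum q c lo hi := by
  induction c generalizing lo with
  | zero => simp [chainSum]
  | succ c ih => exact Finset.sum_nonneg fun k _ => mul_nonneg (qweight_nonneg hq0 hq1 k) (ih k)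

theorem chainSum_le (c lo hi : ℕ) : chainSum q c lo hi ≤ (1 - q)⁻¹ ^ c ∧
    chainSum q (c + 1) lo hi ≤ (1 - q)⁻¹ ^ (c + 1) * q ^ lo := by
  have hinv : 0 < (1 - q)⁻¹ := inv_pos.2 (by linarith)
  have step : ∀ c, (∀ lo, chainSum q c lo hi ≤ (1 - q)⁻¹ ^ c) → ∀ lo,
      chainSum q (c + 1) lo hi ≤ (1 - q)⁻¹ ^ (c + 1) * q ^ lo := by
    intro c hc lo
    calc chainSum q (c + 1) lo hi
        ≤ ∑ k ∈ Finset.Icc lo hi, qweight q k * (1 - q)⁻¹ ^ c :=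
          Finset.sum_le_sum fun k _ => mul_le_mul_of_nonneg_left (hc k) (qweight_nonneg hq0 hq1 k)
      _ = (∑ k ∈ Finset.Icc lo hi, qweight q k) * (1 - q)⁻¹ ^ c := by rw [Finset.sum_mul]
      _ ≤ (q ^ lo * (1 - q)⁻¹) * (1 - q)⁻¹ ^ c := by
          gcongr
          exact sum_Icc_qweight_le hq0 hq1 lo hi
      _ = _ := by ring
  have main : ∀ c lo, chainSum q c lo hi ≤ (1 - q)⁻¹ ^ c := by
    intro c
    induction c with
    | zero => simp [chainSum]
    | succ c ih =>
      intro lo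
      refine (step c ih lo).trans (mul_le_of_le_one_right (by positivity) ?_)
      exact pow_le_one₀ hq0.le hq1.le
  exact ⟨main c lo, step c (main c) lo⟩

theorem hasSum_qweight_sub_mul_chainSum (c l : ℕ) :
    HasSum (fun k : ℕ => (qweight q (k + 1) - qweight q (l + k + 1)) *
      chainSum q c (k + 1) (l + k + 1)) (chainSum q (c + 1) 1 l) := by
  have hlim : Filter.Tendsto (fun k : ℕ => chainSum q (c + 1) (k + 1) (l + k)) Filter.atTop
      (nhds 0) := by
    refine squeeze_zero (fun k => chainSum_nonneg hq0 hq1 _ _ _)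
      (fun k => (chainSum_le hq0 hq1 c (k + 1) (l + k)).2) ?_
    have := ((tendsto_pow_atTop_nhds_zero_of_lt_one hq0.le hq1).comp
      (Filter.tendsto_add_atTop_nat 1)).const_mul ((1 - q)⁻¹ ^ (c + 1))
    simpa using this
  have htel : ∀ k, (qweight q (k + 1) - qweight q (l + k + 1)) *
      chainSum q c (k + 1) (l + k + 1) =
      chainSum q (c + 1) (k + 1) (l + k) - chainSum q (c + 1) (k + 1 + 1) (l + (k + 1)) := by
    intro k
    have h1 := chainSum_succ_left q c (lo := k + 1) (hi := l + k + 1) (by omega)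
    have h2 := chainSum_succ_right q c (lo := k + 1) (hi := l + k) (by omega)
    rw [← add_assoc l k 1]
    linarith
  have hmono : ∀ k, qweight q (l + k + 1) ≤ qweight q (k + 1) := by
    intro k
    have hk := one_le_qnum hq0 hq1 (Nat.succ_pos k)
    refine div_le_div₀ (by positivity) (pow_le_pow_of_le_one hq0.le hq1.le (by omega))
      (by linarith) ?_
    rw [qnum, qnum]
    have : q ^ (l + k + 1) ≤ q ^ (k + 1) := pow_le_pow_of_le_one hq0.le hq1.le (by omega)
    exact div_le_div_of_nonneg_right (by linarith) (by linarith)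
  rw [hasSum_iff_tendsto_nat_of_nonneg fun k =>
    mul_nonneg (sub_nonneg.2 (hmono k)) (chainSum_nonneg hq0 hq1 _ _ _)]
  have hsum : ∀ n, ∑ k ∈ Finset.range n, (qweight q (k + 1) - qweight q (l + k + 1)) *
      chainSum q c (k + 1) (l + k + 1) =
      chainSum q (c + 1) 1 l - chainSum q (c + 1) (n + 1) (l + n) := by
    intro n
    simp only [htel]
    rw [Finset.sum_range_sub' (fun k => chainSum q (c + 1) (k + 1) (l + k))]
    simp
  simp only [hsum]
  simpa using hlim.const_sub (chainSum q (c + 1) 1 l)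

end Bounds

/-- The last entry of a tuple, with the convention that it is `0` for the empty tuple. -/
def lastD : {a : ℕ} → (Fin a → ℕ) → ℕ
  | 0, _ => 0
  | a + 1, x => x (Fin.last a)

theorem lastD_eq_dite {a : ℕ} (x : Fin a → ℕ) :
    lastD x = if h : 0 < a then x ⟨a - 1, by omega⟩ else 0 := by
  cases a <;> simp [lastD, Fin.last]

theorem mem_qIdx_snoc_iff {a : ℕ} {x : Fin a → ℕ} {m : ℕ} :
    (StrictMono (Fin.snoc x m : Fin (a + 1) → ℕ) ∧
      ∀ j, 0 < (Fin.snoc x m : Fin (a + 1) → ℕ) j) ↔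
    (StrictMono x ∧ ∀ j, 0 < x j) ∧ lastD x < m := by
  constructor
  · rintro ⟨h1, h2⟩
    refine ⟨⟨fun i j hij => ?_, fun j => by simpa using h2 j.castSucc⟩, ?_⟩
    · simpa using h1 (Fin.castSucc_lt_castSucc_iff.2 hij)
    · cases a with
      | zero => exact (h2 (Fin.last 0)).trans_eq (Fin.snoc_last (α := fun _ => ℕ) m x)
      | succ a => simpa [lastD] using h1 (Fin.castSucc_lt_last (Fin.last a))
  · rintro ⟨⟨h1, h2⟩, h3⟩
    have h4 : ∀ j, x j < m := by
      intro j
      cases a with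
      | zero => exact j.elim0
      | succ a => exact (h1.monotone (Fin.le_last j)).trans_lt h3
    refine ⟨fun i j hij => ?_, fun j => ?_⟩
    · induction j using Fin.lastCases with
      | last =>
        induction i using Fin.lastCases with
        | last => exact absurd hij (lt_irrefl _)
        | cast i => simpa using h4 i
      | cast j =>
        induction i using Fin.lastCases with
        | last => exact absurd hij (not_lt.2 (Fin.le_last _))
        | cast i => simpa using h1 (Fin.castSucc_lt_castSucc_iff.1 hij)
    · induction j using Fin.lastCases with
      | last => simpa using (Nat.zero_le _).trans_lt h3
      | cast j => simpa using h2 j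

namespace qIdx

/-- Append a larger last entry to an index tuple. -/
def snoc {a : ℕ} (x : qIdx a) (m : ℕ) (h : lastD x.1 < m) : qIdx (a + 1) :=
  ⟨Fin.snoc x.1 m, mem_qIdx_snoc_iff.2 ⟨x.2, h⟩⟩

/-- Remove the last entry of an index tuple. -/
def init {a : ℕ} (n : qIdx (a + 1)) : qIdx a :=
  ⟨Fin.init n.1, by
    have h := n.2
    rw [← Fin.snoc_init_self n.1] at h
    exact (mem_qIdx_snoc_iff.1 h).1⟩

/-- The last entry of a nonempty index tuple. -/
def last {a : ℕ} (n : qIdx (a + 1)) : ℕ := n.1 (Fin.last a)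

/-- The difference of the two last entries of an index tuple. -/
def gap {a : ℕ} (n : qIdx (a + 1)) : ℕ := n.last - lastD n.init.1

theorem gap_def {a : ℕ} (n : qIdx (a + 1)) : n.gap = n.last - lastD n.init.1 := rfl

theorem lastD_init_lt {a : ℕ} (n : qIdx (a + 1)) : lastD n.init.1 < n.last := by
  have h := n.2
  rw [← Fin.snoc_init_self n.1] at h
  exact (mem_qIdx_snoc_iff.1 h).2

theorem gap_pos {a : ℕ} (n : qIdx (a + 1)) : 1 ≤ n.gap :=
  Nat.sub_pos_of_lt n.lastD_init_lt

theorem gap_le {a : ℕ} (n : qIdx (a + 1)) : n.gap ≤ n.last := Nat.sub_le _ _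

theorem last_pos {a : ℕ} (n : qIdx (a + 1)) : 0 < n.last := n.2.2 _

theorem lastD_eq_last {a : ℕ} (n : qIdx (a + 1)) : lastD n.1 = n.last := rfl

theorem init_last_lt {a : ℕ} (n : qIdx (a + 2)) : n.init.last < n.last := n.lastD_init_lt

theorem gap_eq {a : ℕ} (n : qIdx (a + 2)) : n.gap = n.last - n.init.last := rfl

@[simp]
theorem init_snoc {a : ℕ} (x : qIdx a) (m : ℕ) (h : lastD x.1 < m) : (x.snoc m h).init = x :=
  Subtype.ext (Fin.init_snoc (α := fun _ => ℕ) m x.1)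

@[simp]
theorem last_snoc {a : ℕ} (x : qIdx a) (m : ℕ) (h : lastD x.1 < m) : (x.snoc m h).last = m :=
  Fin.snoc_last (α := fun _ => ℕ) m x.1

theorem snoc_init_last {a : ℕ} (n : qIdx (a + 1)) : n.init.snoc n.last n.lastD_init_lt = n :=
  Subtype.ext (Fin.snoc_init_self n.1)

theorem ext_init_last {a : ℕ} {n n' : qIdx (a + 1)} (h1 : n.init = n'.init)
    (h2 : n.last = n'.last) : n = n' := by
  rw [← snoc_init_last n, ← snoc_init_last n']
  congr 1

/-- An index tuple of length `a + 2` is one of length `a + 1` with an arbitrary larger entry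
appended. -/
def appendEquiv (a : ℕ) : qIdx (a + 1) × ℕ ≃ qIdx (a + 2) where
  toFun p := p.1.snoc (p.1.last + p.2 + 1) (by rw [lastD_eq_last]; omega)
  invFun n := (n.init, n.last - n.init.last - 1)
  left_inv p := by
    refine Prod.ext (by simp) ?_
    simp only [init_snoc, last_snoc]
    omega
  right_inv n := by
    have := n.init_last_lt
    refine ext_init_last (by simp) ?_
    simp only [last_snoc]
    omega

/-- An index tuple of length `a + 2` is one of length `a + 1` with an entry inserted before the
last one. -/
noncomputable def insertEquiv (a : ℕ) :
    (Σ n : qIdx (a + 1), Finset.Ico 1 n.gap) ≃ qIdx (a + 2) where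
  toFun p := (p.1.init.snoc (p.1.last - p.2.1) (by
      have h := Finset.mem_Ico.1 p.2.2
      have h' := p.1.gap_def
      omega)).snoc p.1.last (by
      have h := Finset.mem_Ico.1 p.2.2
      have h' := p.1.gap_le
      rw [lastD_eq_last, last_snoc]
      omega)
  invFun n := ⟨n.init.init.snoc n.last (n.init.lastD_init_lt.trans n.init_last_lt),
    n.last - n.init.last, by
      have h1 := n.init_last_lt
      have h2 := n.init.lastD_init_lt
      rw [Finset.mem_Ico, gap_def, init_snoc, last_snoc]
      omega⟩
  left_inv := by
    rintro ⟨n, j, hj⟩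
    have h : n.init.snoc n.last n.lastD_init_lt = n := n.snoc_init_last
    have h' := n.gap_le
    rw [Finset.mem_Ico] at hj
    refine Sigma.subtype_ext ?_ ?_
    · simpa using h
    · simp only [init_snoc, last_snoc]
      omega
  right_inv n := by
    have := n.init_last_lt
    refine ext_init_last (ext_init_last (by simp) ?_) (by simp)
    simp only [init_snoc, last_snoc]
    omega

theorem init_appendEquiv {a : ℕ} (p : qIdx (a + 1) × ℕ) : (appendEquiv a p).init = p.1 := by
  simp [appendEquiv]

theorem last_appendEquiv {a : ℕ} (p : qIdx (a + 1) × ℕ) :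
    (appendEquiv a p).last = p.1.last + p.2 + 1 := by
  simp [appendEquiv]

theorem gap_appendEquiv {a : ℕ} (p : qIdx (a + 1) × ℕ) : (appendEquiv a p).gap = p.2 + 1 := by
  rw [gap_eq, init_appendEquiv, last_appendEquiv]
  omega

theorem init_init_insertEquiv {a : ℕ} (p : Σ n : qIdx (a + 1), Finset.Ico 1 n.gap) :
    (insertEquiv a p).init.init = p.1.init := by
  simp [insertEquiv]

theorem last_insertEquiv {a : ℕ} (p : Σ n : qIdx (a + 1), Finset.Ico 1 n.gap) :
    (insertEquiv a p).last = p.1.last := by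
  simp [insertEquiv]

theorem gap_insertEquiv {a : ℕ} (p : Σ n : qIdx (a + 1), Finset.Ico 1 n.gap) :
    (insertEquiv a p).gap = p.2.1 := by
  have hp := Finset.mem_Ico.1 p.2.2
  have := p.1.gap_le
  rw [gap_eq]
  simp only [insertEquiv, Equiv.coe_fn_mk, init_snoc, last_snoc]
  omega

end qIdx

/-- The index tuple underlying an element of `GIdx a b`. -/
def GIdx.idx {a b : ℕ} (p : GIdx a b) : qIdx (a + 1) :=
  qIdx.snoc ⟨p.1.1, p.2.1, p.2.2.1⟩ p.1.2.1 (by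
    obtain ⟨⟨x, m, y⟩, h1, h2, h3, h4, h5⟩ := p
    cases a with
    | zero => exact h3
    | succ a => exact h4 (Fin.last a))

theorem GIdx.init_idx {a b : ℕ} (p : GIdx a b) : p.idx.init.1 = p.1.1 :=
  congrArg Subtype.val (qIdx.init_snoc _ _ _)

theorem GIdx.last_idx {a b : ℕ} (p : GIdx a b) : p.idx.last = p.1.2.1 :=
  qIdx.last_snoc _ _ _

/-- An element of `GIdx a b` is an index tuple of length `a + 1` together with a chain. -/
noncomputable def gIdxEquiv (a b : ℕ) :
    (Σ n : qIdx (a + 1), chains (b - 1) n.gap n.last) ≃ GIdx a b where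
  toFun p := ⟨(p.1.init.1, p.1.last, p.2.1), by
    have h := mem_chains.1 p.2.2
    refine ⟨p.1.init.2.1, p.1.init.2.2, p.1.last_pos, fun j => ?_, h.1, ?_⟩
    · exact p.1.2.1 (Fin.castSucc_lt_last j)
    · rw [← lastD_eq_dite]
      exact h.2⟩
  invFun p := ⟨p.idx, p.1.2.2, by
      rw [mem_chains, qIdx.gap_def, p.init_idx, p.last_idx, lastD_eq_dite]
      exact p.2.2.2.2.2⟩
  left_inv := by
    rintro ⟨n, x, hx⟩
    refine Sigma.subtype_ext ?_ ?_
    · exact qIdx.snoc_init_last n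
    · rfl
  right_inv p := Subtype.ext (Prod.ext p.init_idx (Prod.ext p.last_idx rfl))

/-- The factor `q^{(s-1)n}/[n]_q^s` of the general term of the `q`-multiple zeta series. -/
noncomputable def zetaFactor (q : ℝ) (s : ℂ) (n : ℕ) : ℂ :=
  (q : ℂ) ^ ((s - 1) * (n : ℂ)) / (qnum q n : ℂ) ^ s

theorem zetaFactor_one (q : ℝ) (n : ℕ) : zetaFactor q 1 n = (qnum q n : ℂ)⁻¹ := by
  simp [zetaFactor]

theorem zetaTerm_snoc (q : ℝ) {a : ℕ} (sv : Fin a → ℂ) (s : ℂ) (n : qIdx (a + 1)) :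
    zetaTerm q (Fin.snoc sv s) n.1 = zetaTerm q sv n.init.1 * zetaFactor q s n.last := by
  rw [zetaTerm, Fin.prod_univ_castSucc]
  simp only [Fin.snoc_castSucc, Fin.snoc_last]
  rfl

/-- The convergence condition for the `q`-multiple zeta series. -/
def ConvCond {r : ℕ} (s : Fin r → ℂ) : Prop :=
  ∀ i, 0 < ∑ j ∈ Finset.Ici i, ((s j).re - 1)

theorem sum_Ici_castSucc {r : ℕ} (f : Fin (r + 1) → ℝ) (i : Fin r) :
    ∑ j ∈ Finset.Ici i.castSucc, f j = ∑ j ∈ Finset.Ici i, f j.castSucc + f (Fin.last r) := by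
  have h : ∀ {r : ℕ} (i : Fin r), Finset.Ici i = Finset.univ.filter fun j => i ≤ j := by
    intro r i
    ext
    simp
  simp only [h, Finset.sum_filter]
  rw [Fin.sum_univ_castSucc]
  simp [Fin.le_last]

theorem convCond_snoc {r : ℕ} {s : Fin r → ℂ} {z : ℂ} :
    ConvCond (Fin.snoc s z : Fin (r + 1) → ℂ) ↔
      1 < z.re ∧ ∀ i, 0 < ∑ j ∈ Finset.Ici i, ((s j).re - 1) + (z.re - 1) := by
  constructor
  · intro h
    refine ⟨?_, fun i => ?_⟩
    · have h' := h (Fin.last r)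
      rw [← Fin.top_eq_last, Finset.Ici_top] at h'
      simpa [Fin.top_eq_last] using h'
    · have h' := h i.castSucc
      rw [sum_Ici_castSucc] at h'
      simpa using h'
  · rintro ⟨h1, h2⟩ i
    induction i using Fin.lastCases with
    | last =>
      rw [← Fin.top_eq_last, Finset.Ici_top]
      simpa [Fin.top_eq_last] using h1
    | cast i =>
      rw [sum_Ici_castSucc]
      simpa using h2 i

theorem ConvCond.split {r : ℕ} {s : Fin r → ℂ} {z α β : ℂ}
    (h : ConvCond (Fin.snoc s z : Fin (r + 1) → ℂ)) (hβ : 1 < β.re) (hz : α + β = z + 1) :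
    ConvCond (Fin.snoc (Fin.snoc s α : Fin (r + 1) → ℂ) β : Fin (r + 2) → ℂ) := by
  rw [convCond_snoc] at h
  have hre : α.re + β.re = z.re + 1 := by simpa using congrArg Complex.re hz
  refine convCond_snoc.2 ⟨hβ, fun i => ?_⟩
  induction i using Fin.lastCases with
  | last =>
    rw [← Fin.top_eq_last, Finset.Ici_top]
    simp [Fin.top_eq_last]
    linarith [h.1]
  | cast i =>
    rw [sum_Ici_castSucc]
    have := h.2 i
    simp
    simp at this
    linarith

section Analysis

variable {q : ℝ} (hq0 : 0 < q) (hq1 : q < 1)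

include hq0 hq1

theorem qnum_pos {n : ℕ} (hn : 0 < n) : 0 < qnum q n :=
  zero_lt_one.trans_le (one_le_qnum hq0 hq1 hn)

theorem qweight_pos {n : ℕ} (hn : 0 < n) : 0 < qweight q n :=
  div_pos (pow_pos hq0 n) (qnum_pos hq0 hq1 hn)

theorem norm_zetaFactor_le (s : ℂ) {n : ℕ} (hn : 0 < n) :
    ‖zetaFactor q s n‖ ≤ (1 - q)⁻¹ ^ |s.re| * (q ^ (s.re - 1)) ^ n := by
  have h1 := one_le_qnum hq0 hq1 hn
  have h0 := qnum_pos hq0 hq1 hn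
  rw [zetaFactor, norm_div, Complex.norm_cpow_eq_rpow_re_of_pos hq0,
    Complex.norm_cpow_eq_rpow_re_of_pos h0, div_eq_mul_inv, mul_comm, ← Real.rpow_neg h0.le]
  have h2 : ((s - 1) * (n : ℂ)).re = (s.re - 1) * n := by simp
  rw [h2, Real.rpow_mul hq0.le, Real.rpow_natCast]
  refine mul_le_mul_of_nonneg_right ?_ (by positivity)
  exact (Real.rpow_le_rpow_of_exponent_le h1 (neg_le_abs _)).trans
    (Real.rpow_le_rpow h0.le (qnum_le hq0 hq1 n) (abs_nonneg _))

theorem zetaFactor_add_nat (s : ℂ) (k : ℕ) {n : ℕ} (hn : 0 < n) :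
    zetaFactor q (s + k) n = zetaFactor q s n * (qweight q n : ℂ) ^ k := by
  have hq : (q : ℂ) ≠ 0 := by exact_mod_cast hq0.ne'
  have hn' : (qnum q n : ℂ) ≠ 0 := by exact_mod_cast (qnum_pos hq0 hq1 hn).ne'
  have h : (s + k - 1) * (n : ℂ) = (s - 1) * n + ((n * k : ℕ) : ℂ) := by
    push_cast
    ring
  rw [zetaFactor, zetaFactor, h, Complex.cpow_add _ _ hq, Complex.cpow_add _ _ hn',
    Complex.cpow_natCast, Complex.cpow_natCast, qweight, pow_mul]
  push_cast
  rw [div_pow, mul_div_mul_comm]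

theorem zetaFactor_add_one (s : ℂ) {n : ℕ} (hn : 0 < n) :
    zetaFactor q (s + 1) n = zetaFactor q s n * (qweight q n : ℂ) := by
  simpa using zetaFactor_add_nat hq0 hq1 s 1 hn

theorem zetaFactor_sub_mul_add (α β : ℂ) (k : ℕ) {l m : ℕ} (hl : 0 < l) (hm : 0 < m) :
    zetaFactor q (α - k) l * zetaFactor q (β + k) m =
      zetaFactor q α l * zetaFactor q β m * ((qweight q m / qweight q l : ℝ) : ℂ) ^ k := by
  have hl' : (qweight q l : ℂ) ≠ 0 := by exact_mod_cast (qweight_pos hq0 hq1 hl).ne'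
  have h := zetaFactor_add_nat hq0 hq1 (α - k) k hl
  rw [sub_add_cancel] at h
  rw [zetaFactor_add_nat hq0 hq1 β k hm, h]
  push_cast
  rw [div_pow]
  field_simp

theorem qweight_mul_sub (l j : ℕ) (hl : 0 < l) (hj : 0 < j) :
    qweight q j * (qweight q l - qweight q (l + j)) * qnum q l = qweight q (l + j) := by
  have h1 : ∀ n : ℕ, 0 < n → 1 - q ^ n ≠ 0 := fun n hn =>
    (sub_pos.2 (pow_lt_one₀ hq0.le hq1 hn.ne')).ne'
  have hl' := h1 l hl
  have hj' := h1 j hj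
  have hlj := h1 (l + j) (by omega)
  have h2 : 1 - q ≠ 0 := by linarith
  simp only [qweight, qnum]
  rw [pow_add] at *
  generalize q ^ l = x at *
  generalize q ^ j = y at *
  have hlj' : 1 - y * x ≠ 0 := by rwa [mul_comm]
  field_simp
  ring

theorem sub_mul_qweight_sub (l j : ℕ) (hl : 0 < l) (hj : 0 < j) :
    (qweight q l - qweight q (l + j)) * (qweight q j - qweight q (l + j)) * qnum q (l + j) =
      qweight q (l + j) := by
  have h1 : ∀ n : ℕ, 0 < n → 1 - q ^ n ≠ 0 := fun n hn =>
    (sub_pos.2 (pow_lt_one₀ hq0.le hq1 hn.ne')).ne'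
  have hl' := h1 l hl
  have hj' := h1 j hj
  have hlj := h1 (l + j) (by omega)
  have h2 : 1 - q ≠ 0 := by linarith
  simp only [qweight, qnum]
  rw [pow_add] at *
  generalize q ^ l = x at *
  generalize q ^ j = y at *
  field_simp
  ring

theorem qweight_div_le {l m : ℕ} (hl : 0 < l) (hlm : l < m) :
    qweight q m / qweight q l ≤ q := by
  rw [div_le_iff₀ (qweight_pos hq0 hq1 hl), qweight, qweight, ← mul_div_assoc, ← pow_succ']
  refine div_le_div₀ (by positivity) (pow_le_pow_of_le_one hq0.le hq1.le hlm)
    (qnum_pos hq0 hq1 hl) ?_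
  rw [qnum, qnum]
  have : q ^ m ≤ q ^ l := pow_le_pow_of_le_one hq0.le hq1.le hlm.le
  exact div_le_div_of_nonneg_right (by linarith) (by linarith)

theorem zetaFactor_mul_geom_left (u : ℂ) {l m : ℕ} (hl : 0 < l) (hlm : l < m) :
    zetaFactor q (u - 1) l * zetaFactor q 2 m *
      (1 - ((qweight q m / qweight q l : ℝ) : ℂ))⁻¹ =
      zetaFactor q u l * ((qweight q (m - l) - qweight q m : ℝ) : ℂ) := by
  obtain ⟨j, rfl⟩ := Nat.exists_eq_add_of_lt hlm
  rw [add_assoc, Nat.add_sub_cancel_left]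
  have hid := sub_mul_qweight_sub hq0 hq1 l (j + 1) hl (Nat.succ_pos j)
  have hwm := qweight_pos hq0 hq1 (n := l + (j + 1)) (by omega)
  have hwl := qweight_pos hq0 hq1 hl
  have hm := qnum_pos hq0 hq1 (n := l + (j + 1)) (by omega)
  have hu := zetaFactor_add_one hq0 hq1 (u - 1) hl
  have h2 := zetaFactor_add_one hq0 hq1 1 (n := l + (j + 1)) (by omega)
  rw [sub_add_cancel] at hu
  rw [one_add_one_eq_two, zetaFactor_one] at h2
  rw [hu, h2]
  have hsub : qweight q l - qweight q (l + (j + 1)) ≠ 0 := by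
    intro h
    rw [h] at hid
    simp at hid
    exact hwm.ne hid
  have key : (qnum q (l + (j + 1)))⁻¹ * qweight q (l + (j + 1)) *
      (1 - qweight q (l + (j + 1)) / qweight q l)⁻¹ =
      qweight q l * (qweight q (j + 1) - qweight q (l + (j + 1))) := by
    have : 1 - qweight q (l + (j + 1)) / qweight q l =
        (qweight q l - qweight q (l + (j + 1))) / qweight q l := by
      field_simp
    rw [this, inv_div]
    field_simp
    linear_combination -hid
  have key' := congrArg (fun x : ℝ => (x : ℂ)) key
  push_cast at key' ⊢
  rw [mul_assoc (zetaFactor q (u - 1) l) (qweight q l : ℂ), ← key']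
  ring

theorem zetaFactor_mul_geom_right (u : ℂ) {l m : ℕ} (hl : 0 < l) (hlm : l < m) :
    zetaFactor q 0 l * zetaFactor q (u + 1) m *
      (1 - ((qweight q m / qweight q l : ℝ) : ℂ))⁻¹ =
      zetaFactor q u m * ((qweight q (m - l) : ℝ) : ℂ) := by
  obtain ⟨j, rfl⟩ := Nat.exists_eq_add_of_lt hlm
  rw [add_assoc, Nat.add_sub_cancel_left]
  have hid := qweight_mul_sub hq0 hq1 l (j + 1) hl (Nat.succ_pos j)
  have hwm := qweight_pos hq0 hq1 (n := l + (j + 1)) (by omega)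
  have hwl := qweight_pos hq0 hq1 hl
  have hl' := qnum_pos hq0 hq1 hl
  have h0 : zetaFactor q 0 l = (((qnum q l)⁻¹ * (qweight q l)⁻¹ : ℝ) : ℂ) := by
    have h := zetaFactor_add_one hq0 hq1 0 hl
    rw [zero_add, zetaFactor_one] at h
    push_cast
    rw [h, mul_inv_cancel_right₀]
    exact_mod_cast hwl.ne'
  rw [h0, zetaFactor_add_one hq0 hq1 u (n := l + (j + 1)) (by omega)]
  have hsub : qweight q l - qweight q (l + (j + 1)) ≠ 0 := by
    intro h
    rw [h] at hid
    simp at hid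
    exact hwm.ne hid
  have key : (qnum q l)⁻¹ * (qweight q l)⁻¹ * qweight q (l + (j + 1)) *
      (1 - qweight q (l + (j + 1)) / qweight q l)⁻¹ = qweight q (j + 1) := by
    have : 1 - qweight q (l + (j + 1)) / qweight q l =
        (qweight q l - qweight q (l + (j + 1))) / qweight q l := by
      field_simp
    rw [this, inv_div]
    field_simp
    linear_combination -hid
  have key' := congrArg (fun x : ℝ => (x : ℂ)) key
  push_cast at key' ⊢
  rw [← key']
  ring

theorem summable_prod_rpow_pow {r : ℕ} (t : Fin r → ℝ)
    (ht : ∀ i, 0 < ∑ j ∈ Finset.Ici i, t j) :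
    Summable fun n : qIdx r => ∏ j, (q ^ t j) ^ n.1 j := by
  induction r with
  | zero =>
    have : Subsingleton (qIdx 0) := ⟨fun x y => Subtype.ext (Subsingleton.elim _ _)⟩
    exact Summable.of_finite
  | succ r ih =>
    have hsum : 0 < ∑ j, t j := by
      have := ht 0
      rwa [show Finset.Ici (0 : Fin (r + 1)) = Finset.univ by ext; simp] at this
    have htail : ∀ i, 0 < ∑ j ∈ Finset.Ici i, t (Fin.succ j) := by
      intro i
      have := ht i.succ
      rw [show Finset.Ici i.succ = (Finset.Ici i).map (Fin.succEmb r) by simp,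
        Finset.sum_map] at this
      exact this
    have h1 : Summable fun d : ℕ => (q ^ ∑ j, t j) ^ (d + 1) :=
      (summable_nat_add_iff 1).2 (summable_geometric_of_lt_one (by positivity)
        (Real.rpow_lt_one hq0.le hq1 hsum))
    have h2 := h1.mul_of_nonneg (ih (fun j => t j.succ) htail) (fun d => by positivity)
      (fun n => Finset.prod_nonneg fun j _ => by positivity)
    have hlt : ∀ (n : qIdx (r + 1)) (j : Fin r), n.1 0 < n.1 j.succ :=
      fun n j => n.2.1 (Fin.succ_pos j)
    let φ : qIdx (r + 1) → ℕ × qIdx r := fun n =>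
      (n.1 0 - 1, ⟨fun j => n.1 j.succ - n.1 0,
        fun i j hij => Nat.sub_lt_sub_right (hlt n i).le (n.2.1 (Fin.succ_lt_succ_iff.2 hij)),
        fun j => Nat.sub_pos_of_lt (hlt n j)⟩)
    have hφ : Function.Injective φ := by
      intro n n' h
      have h0 : n.1 0 - 1 = n'.1 0 - 1 := congrArg Prod.fst h
      have h0' : n.1 0 = n'.1 0 := by
        have := n.2.2 0
        have := n'.2.2 0
        omega
      refine Subtype.ext (funext fun j => ?_)
      induction j using Fin.cases with
      | zero => exact h0'
      | succ j =>
        have hj : n.1 j.succ - n.1 0 = n'.1 j.succ - n'.1 0 :=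
          congrFun (congrArg (fun p => p.2.1) h) j
        have := hlt n j
        have := hlt n' j
        omega
    refine (h2.comp_injective hφ).congr fun n => ?_
    have hn : n.1 0 - 1 + 1 = n.1 0 := Nat.sub_add_cancel (n.2.2 0)
    simp only [Function.comp, φ, hn]
    rw [Fin.prod_univ_succ, Fin.sum_univ_succ, Real.rpow_add hq0, mul_pow, mul_assoc]
    congr 1
    rw [Real.rpow_sum_of_pos hq0, ← Finset.prod_pow, ← Finset.prod_mul_distrib]
    refine Finset.prod_congr rfl fun j _ => ?_
    rw [← pow_add, Nat.add_sub_cancel' (hlt n j).le]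

theorem summable_zetaTerm {r : ℕ} {s : Fin r → ℂ} (hs : ConvCond s) :
    Summable fun n : qIdx r => zetaTerm q s n.1 := by
  refine Summable.of_norm_bounded ((summable_prod_rpow_pow hq0 hq1 _ hs).mul_left
    (∏ j, (1 - q)⁻¹ ^ |(s j).re|)) fun n => ?_
  rw [zetaTerm, norm_prod, ← Finset.prod_mul_distrib]
  exact Finset.prod_le_prod (fun j _ => norm_nonneg _)
    fun j _ => norm_zetaFactor_le hq0 hq1 (s j) (n.2.2 j)

theorem summable_zetaTerm_mul_chainSum {r : ℕ} {s : Fin r → ℂ} (hs : ConvCond s) (c : ℕ)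
    (lo hi : qIdx r → ℕ) :
    Summable fun n : qIdx r => zetaTerm q s n.1 * (chainSum q c (lo n) (hi n) : ℂ) := by
  refine Summable.of_norm_bounded ((summable_zetaTerm hq0 hq1 hs).norm.mul_right
    ((1 - q)⁻¹ ^ c)) fun n => ?_
  rw [norm_mul, Complex.norm_real, Real.norm_of_nonneg (chainSum_nonneg hq0 hq1 _ _ _)]
  gcongr
  exact (chainSum_le hq0 hq1 c _ _).1

end Analysis

theorem tsum_mul_geometric {ι : Type*} {f r : ι → ℂ} {ρ : ℝ} (hρ0 : 0 ≤ ρ) (hρ1 : ρ < 1)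
    (hf : Summable f) (hr : ∀ i, ‖r i‖ ≤ ρ) :
    Summable (fun n : ℕ => ∑' i, f i * r i ^ n) ∧
    Summable (fun i => f i * (1 - r i)⁻¹) ∧
    ∑' n : ℕ, ∑' i, f i * r i ^ n = ∑' i, f i * (1 - r i)⁻¹ := by
  have h : Summable fun p : ℕ × ι => f p.2 * r p.2 ^ p.1 := by
    refine Summable.of_norm_bounded ((summable_geometric_of_lt_one hρ0 hρ1).mul_of_nonneg hf.norm
      (fun n => by positivity) (fun i => norm_nonneg _)) fun p => ?_
    rw [norm_mul, norm_pow, mul_comm]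
    gcongr
    exact hr _
  have hg : ∀ i, ∑' n : ℕ, f i * r i ^ n = f i * (1 - r i)⁻¹ := fun i => by
    rw [tsum_mul_left, tsum_geometric_of_norm_lt_one ((hr i).trans_lt hρ1)]
  have h' : Summable fun p : ι × ℕ => f p.1 * r p.1 ^ p.2 := h.prod_symm
  refine ⟨h.prod, ?_, ?_⟩
  · simpa only [hg] using h'.prod
  · rw [← tsum_congr hg]
    exact h.tsum_comm.symm

/-- The general term of the series representation of `G_q^{(a,c+1)}`, summed over all chains. -/
noncomputable def gTerm (q : ℝ) (c : ℕ) {a : ℕ} (sv : Fin a → ℂ) (s : ℂ) (n : qIdx (a + 1)) : ℂ :=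
  zetaTerm q (Fin.snoc sv s) n.1 * (chainSum q c n.gap n.last : ℂ)

section Recursion

variable {q : ℝ} (hq0 : 0 < q) (hq1 : q < 1)

include hq0 hq1

theorem gTerm_shift (c : ℕ) {a : ℕ} (sv : Fin a → ℂ) (α β : ℂ) (k : ℕ) (ν : qIdx (a + 2)) :
    gTerm q c (Fin.snoc sv (α - k) : Fin (a + 1) → ℂ) (β + k) ν =
      gTerm q c (Fin.snoc sv α : Fin (a + 1) → ℂ) β ν *
        ((qweight q ν.last / qweight q ν.init.last : ℝ) : ℂ) ^ k := by
  have h := zetaFactor_sub_mul_add hq0 hq1 α β k ν.init.last_pos ν.last_pos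
  simp only [gTerm, zetaTerm_snoc]
  rw [mul_assoc (zetaTerm q sv ν.init.init.1), h]
  ring

theorem norm_qweight_ratio_le {a : ℕ} (ν : qIdx (a + 2)) :
    ‖((qweight q ν.last / qweight q ν.init.last : ℝ) : ℂ)‖ ≤ q := by
  rw [Complex.norm_real, Real.norm_of_nonneg
    (div_nonneg (qweight_nonneg hq0 hq1 _) (qweight_nonneg hq0 hq1 _))]
  exact qweight_div_le hq0 hq1 ν.init.last_pos ν.init_last_lt

theorem summable_gTerm (c : ℕ) {a : ℕ} {sv : Fin a → ℂ} {s : ℂ}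
    (h : ConvCond (Fin.snoc sv s : Fin (a + 1) → ℂ)) : Summable (gTerm q c sv s) :=
  summable_zetaTerm_mul_chainSum hq0 hq1 h c _ _

theorem tsum_gTerm_shift (c : ℕ) {a : ℕ} {sv : Fin a → ℂ} {α β : ℂ}
    (h : ConvCond (Fin.snoc (Fin.snoc sv α : Fin (a + 1) → ℂ) β : Fin (a + 2) → ℂ)) :
    let F := fun ν : qIdx (a + 2) => gTerm q c (Fin.snoc sv α : Fin (a + 1) → ℂ) β ν *
      (1 - ((qweight q ν.last / qweight q ν.init.last : ℝ) : ℂ))⁻¹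
    Summable (fun k : ℕ => ∑' ν, gTerm q c (Fin.snoc sv (α - k) : Fin (a + 1) → ℂ) (β + k) ν) ∧
    Summable F ∧
    ∑' k : ℕ, ∑' ν, gTerm q c (Fin.snoc sv (α - k) : Fin (a + 1) → ℂ) (β + k) ν = ∑' ν, F ν := by
  simp only [gTerm_shift hq0 hq1]
  exact tsum_mul_geometric hq0.le hq1 (summable_gTerm hq0 hq1 c h)
    (norm_qweight_ratio_le hq0 hq1)

theorem gTerm_mul_geom_left (c : ℕ) {a : ℕ} (sv : Fin a → ℂ) (u : ℂ) (ν : qIdx (a + 2)) :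
    gTerm q c (Fin.snoc sv (u - 1) : Fin (a + 1) → ℂ) 2 ν *
      (1 - ((qweight q ν.last / qweight q ν.init.last : ℝ) : ℂ))⁻¹ =
    zetaTerm q (Fin.snoc sv u) ν.init.1 * (((qweight q ν.gap - qweight q ν.last) *
      chainSum q c ν.gap ν.last : ℝ) : ℂ) := by
  have h := zetaFactor_mul_geom_left hq0 hq1 u ν.init.last_pos ν.init_last_lt
  rw [← ν.gap_eq] at h
  simp only [gTerm, zetaTerm_snoc]
  rw [Complex.ofReal_mul]
  linear_combination (zetaTerm q sv ν.init.init.1 * (chainSum q c ν.gap ν.last : ℂ)) * h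

theorem gTerm_mul_geom_right (c : ℕ) {a : ℕ} (sv : Fin a → ℂ) (u : ℂ) (ν : qIdx (a + 2)) :
    gTerm q c (Fin.snoc sv 0 : Fin (a + 1) → ℂ) (u + 1) ν *
      (1 - ((qweight q ν.last / qweight q ν.init.last : ℝ) : ℂ))⁻¹ =
    zetaTerm q sv ν.init.init.1 * zetaFactor q u ν.last * ((qweight q ν.gap *
      chainSum q c ν.gap ν.last : ℝ) : ℂ) := by
  have h := zetaFactor_mul_geom_right hq0 hq1 u ν.init.last_pos ν.init_last_lt
  rw [← ν.gap_eq] at h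
  simp only [gTerm, zetaTerm_snoc]
  rw [Complex.ofReal_mul]
  linear_combination (zetaTerm q sv ν.init.init.1 * (chainSum q c ν.gap ν.last : ℂ)) * h

theorem tsum_gTerm_left (c : ℕ) {a : ℕ} {sv : Fin a → ℂ} {u : ℂ}
    (h : ConvCond (Fin.snoc sv u : Fin (a + 1) → ℂ)) :
    Summable (fun k : ℕ =>
      ∑' ν, gTerm q c (Fin.snoc sv (u - 1 - k) : Fin (a + 1) → ℂ) (2 + k) ν) ∧
    ∑' k : ℕ, ∑' ν, gTerm q c (Fin.snoc sv (u - 1 - k) : Fin (a + 1) → ℂ) (2 + k) ν =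
      ∑' n : qIdx (a + 1), zetaTerm q (Fin.snoc sv u) n.1 * (chainSum q (c + 1) 1 n.last : ℂ) := by
  obtain ⟨h1, h2, h3⟩ := tsum_gTerm_shift hq0 hq1 c (h.split (α := u - 1) (β := 2)
    (by norm_num) (by ring))
  simp only [gTerm_mul_geom_left hq0 hq1] at h2 h3
  refine ⟨h1, h3.trans ?_⟩
  rw [← (qIdx.appendEquiv a).tsum_eq]
  rw [← (qIdx.appendEquiv a).summable_iff] at h2
  simp only [Function.comp_def, qIdx.gap_appendEquiv, qIdx.init_appendEquiv,
    qIdx.last_appendEquiv] at h2 ⊢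
  rw [h2.tsum_prod]
  refine tsum_congr fun n => ?_
  dsimp only
  rw [tsum_mul_left]
  congr 1
  rw [← Complex.ofReal_tsum, (hasSum_qweight_sub_mul_chainSum hq0 hq1 c n.last).tsum_eq]

theorem tsum_gTerm_right (c : ℕ) {a : ℕ} {sv : Fin a → ℂ} {u : ℂ}
    (h : ConvCond (Fin.snoc sv u : Fin (a + 1) → ℂ)) :
    Summable (fun k : ℕ =>
      ∑' ν, gTerm q c (Fin.snoc sv (0 - k) : Fin (a + 1) → ℂ) (u + 1 + k) ν) ∧
    ∑' k : ℕ, ∑' ν, gTerm q c (Fin.snoc sv (0 - k) : Fin (a + 1) → ℂ) (u + 1 + k) ν =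
      ∑' n : qIdx (a + 1), zetaTerm q (Fin.snoc sv u) n.1 *
        ((chainSum q (c + 1) 1 n.last - chainSum q (c + 1) n.gap n.last : ℝ) : ℂ) := by
  have hu : 1 < (u + 1).re := by
    have := (convCond_snoc.1 h).1
    simp
    linarith
  obtain ⟨h1, h2, h3⟩ := tsum_gTerm_shift hq0 hq1 c (h.split (α := 0) hu (by ring))
  simp only [gTerm_mul_geom_right hq0 hq1] at h2 h3
  refine ⟨h1, h3.trans ?_⟩
  rw [← (qIdx.insertEquiv a).tsum_eq]
  rw [← (qIdx.insertEquiv a).summable_iff] at h2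
  simp only [Function.comp_def, qIdx.gap_insertEquiv, qIdx.init_init_insertEquiv,
    qIdx.last_insertEquiv] at h2 ⊢
  rw [h2.tsum_sigma]
  refine tsum_congr fun n => ?_
  dsimp only
  rw [zetaTerm_snoc, tsum_mul_left,
    ← sum_Ico_qweight_mul_chainSum q c n.gap_pos n.gap_le]
  congr 1
  rw [← Complex.ofReal_tsum,
    Finset.tsum_subtype (Finset.Ico 1 n.gap) fun j => qweight q j * chainSum q c j n.last]

theorem Gq_eq_tsum_gTerm (c : ℕ) {a : ℕ} {sv : Fin a → ℂ} {s : ℂ}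
    (h : ConvCond (Fin.snoc sv (s - c) : Fin (a + 1) → ℂ)) :
    GqSummable q (c + 1) a sv s ∧ Gq q (c + 1) a sv s = ∑' n, gTerm q c sv (s - c) n := by
  induction c generalizing a s with
  | zero =>
    rw [Nat.cast_zero, sub_zero] at *
    exact ⟨summable_zetaTerm hq0 hq1 h, by simp [Gq, qMZF, gTerm, chainSum]⟩
  | succ c ih =>
    have hre := (convCond_snoc.1 h).1
    have hleft : ∀ k : ℕ, GqSummable q (c + 1) (a + 1) (Fin.snoc sv (s - (k : ℂ) - ((c : ℂ) + 2)))
          ((k : ℂ) + ((c : ℂ) + 2)) ∧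
        Gq q (c + 1) (a + 1) (Fin.snoc sv (s - (k : ℂ) - ((c : ℂ) + 2)))
          ((k : ℂ) + ((c : ℂ) + 2)) =
        ∑' ν, gTerm q c (Fin.snoc sv (s - (c + 1 : ℕ) - 1 - k) : Fin (a + 1) → ℂ) (2 + k) ν := by
      intro k
      have hα : s - (k : ℂ) - ((c : ℂ) + 2) = s - (c + 1 : ℕ) - 1 - k := by
        push_cast
        ring
      have hβ : (k : ℂ) + ((c : ℂ) + 2) - c = 2 + k := by ring
      rw [hα, ← hβ]
      refine ih (h.split ?_ ?_)
      · rw [hβ]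
        have : (0 : ℝ) ≤ k := k.cast_nonneg
        simp
        linarith
      · push_cast
        ring
    have hright : ∀ k : ℕ, GqSummable q (c + 1) (a + 1) (Fin.snoc sv (-(k : ℂ))) (s + (k : ℂ)) ∧
        Gq q (c + 1) (a + 1) (Fin.snoc sv (-(k : ℂ))) (s + (k : ℂ)) =
        ∑' ν, gTerm q c (Fin.snoc sv (0 - (k : ℂ)) : Fin (a + 1) → ℂ)
          (s - (c + 1 : ℕ) + 1 + k) ν := by
      intro k
      have hβ : s + (k : ℂ) - c = s - (c + 1 : ℕ) + 1 + k := by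
        push_cast
        ring
      rw [zero_sub, ← hβ]
      refine ih (h.split ?_ ?_)
      · rw [hβ]
        simp at hre ⊢
        have : (0 : ℝ) ≤ k := k.cast_nonneg
        linarith
      · push_cast
        ring
    obtain ⟨hl1, hl2⟩ := tsum_gTerm_left hq0 hq1 c h
    obtain ⟨hr1, hr2⟩ := tsum_gTerm_right hq0 hq1 c h
    simp only [← fun k => (hleft k).2] at hl1 hl2
    simp only [← fun k => (hright k).2] at hr1 hr2
    refine ⟨⟨fun k => (hleft k).1, fun k => (hright k).1, hl1, hr1⟩, ?_⟩
    rw [Gq, hl2, hr2]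
    have hS1 := summable_zetaTerm_mul_chainSum hq0 hq1 h (c + 1) (fun _ => 1) qIdx.last
    have hS2 := summable_gTerm hq0 hq1 (c + 1) h
    have hS3 := hS1.sub hS2
    simp only [gTerm, ← mul_sub, ← Complex.ofReal_sub] at hS3
    rw [← hS1.tsum_sub hS3]
    refine tsum_congr fun n => ?_
    rw [gTerm]
    push_cast
    ring

end Recursion

theorem GqRepTerm_gIdxEquiv (q : ℝ) {a c : ℕ} (sv : Fin a → ℂ) (s : ℂ) (n : qIdx (a + 1))
    (x : chains (c + 1 - 1) n.gap n.last) :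
    GqRepTerm (b := c + 1) q sv s (gIdxEquiv a (c + 1) ⟨n, x⟩).1 =
      zetaTerm q (Fin.snoc sv (s - c)) n.1 * ((∏ i, qweight q (x.1 i) : ℝ) : ℂ) := by
  have h1 : s - ((c + 1 : ℕ) : ℂ) = s - c - 1 := by
    push_cast
    ring
  rw [zetaTerm_snoc, GqRepTerm, h1, sub_add_cancel]
  push_cast [qweight]
  rfl

theorem summable_GqRepTerm_and_tsum {q : ℝ} (hq0 : 0 < q) (hq1 : q < 1) (c : ℕ) {a : ℕ}
    {sv : Fin a → ℂ} {s : ℂ} (h : ConvCond (Fin.snoc sv (s - c) : Fin (a + 1) → ℂ)) :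
    Summable (fun p : GIdx a (c + 1) => GqRepTerm q sv s p.1) ∧
    ∑' p : GIdx a (c + 1), GqRepTerm q sv s p.1 = ∑' n, gTerm q c sv (s - c) n := by
  have hfib : ∀ n : qIdx (a + 1),
      ∑ x : chains (c + 1 - 1) n.gap n.last, ∏ i, qweight q (x.1 i) =
        chainSum q c n.gap n.last := fun n => by
    rw [← sum_chains_eq_chainSum]
    exact Finset.sum_coe_sort (chains c n.gap n.last) fun x => ∏ i, qweight q (x i)
  have hsum : Summable fun p : (Σ n : qIdx (a + 1), chains (c + 1 - 1) n.gap n.last) =>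
      GqRepTerm (b := c + 1) q sv s (gIdxEquiv a (c + 1) p).1 := by
    refine Summable.of_norm ((summable_sigma_of_nonneg fun _ => norm_nonneg _).2
      ⟨fun n => Summable.of_finite, ?_⟩)
    refine (summable_gTerm hq0 hq1 c h).norm.congr fun n => ?_
    have hx : ∀ x : chains (c + 1 - 1) n.gap n.last, 0 ≤ ∏ i, qweight q (x.1 i) :=
      fun x => Finset.prod_nonneg fun i _ => qweight_nonneg hq0 hq1 _
    rw [tsum_fintype]
    simp only [GqRepTerm_gIdxEquiv, norm_mul, Complex.norm_real, Real.norm_of_nonneg (hx _)]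
    rw [← Finset.mul_sum, hfib, gTerm, norm_mul, Complex.norm_real,
      Real.norm_of_nonneg (chainSum_nonneg hq0 hq1 _ _ _)]
  refine ⟨(gIdxEquiv a (c + 1)).summable_iff.1 hsum, ?_⟩
  rw [← (gIdxEquiv a (c + 1)).tsum_eq, hsum.tsum_sigma]
  refine tsum_congr fun n => ?_
  rw [tsum_fintype]
  simp only [GqRepTerm_gIdxEquiv]
  rw [← Finset.mul_sum, ← Complex.ofReal_sum, hfib, gTerm]

theorem convCond_of_re_lt {a c : ℕ} {sv : Fin a → ℂ} {s : ℂ} (hs : ((c + 1 : ℕ) : ℝ) < s.re)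
    (hsv : ∀ k : ℕ, 1 ≤ k → k ≤ a → ((k + (c + 1) : ℕ) : ℝ) <
      (s + ∑ j ∈ Finset.univ.filter (fun j : Fin a => a - k ≤ (j : ℕ)), sv j).re) :
    ConvCond (Fin.snoc sv (s - c) : Fin (a + 1) → ℂ) := by
  push_cast at hs
  refine convCond_snoc.2 ⟨?_, fun i => ?_⟩
  · simp
    linarith
  · have h := hsv (a - i) (by omega) (by omega)
    have hfil : Finset.univ.filter (fun j : Fin a => a - (a - (i : ℕ)) ≤ (j : ℕ)) =
        Finset.Ici i := by
      ext j
      simp only [Finset.mem_filter, Finset.mem_univ, true_and, Finset.mem_Ici, Fin.le_def]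
      omega
    rw [hfil] at h
    rw [Finset.sum_sub_distrib, Finset.sum_const, Fin.card_Ici]
    simp at h ⊢
    linarith

/-- Series representation of `G_q^{(a,b)}(s₁,…,s_a;s)`: under the convergence conditions
`Re(s) > b` and `Re(s + s_{a−k+1} + ⋯ + s_a) > k + b` for `k = 1,…,a`, all the series in
the recursive definition converge absolutely and
`G_q^{(a,b)}(s₁,…,s_a;s) = Σ_{0<m₁<⋯<m_a<m} (q^{(s₁−1)m₁+⋯+(s_a−1)m_a+(s−b)m} /
  ([m₁]^{s₁}⋯[m_a]^{s_a}[m]^{s−b+1})) Σ_{m−m_a≤x₁≤⋯≤x_{b−1}≤m} q^{x₁+⋯+x_{b−1}}/([x₁]⋯[x_{b−1}])`. -/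
theorem Gq_series_representation (q : ℝ) (hq0 : 0 < q) (hq1 : q < 1)
    (a b : ℕ) (hb : 1 ≤ b) (sv : Fin a → ℂ) (s : ℂ) (hs : (b : ℝ) < s.re)
    (hsv : ∀ k : ℕ, 1 ≤ k → k ≤ a →
      ((k + b : ℕ) : ℝ) <
        (s + ∑ j ∈ Finset.univ.filter (fun j : Fin a => a - k ≤ (j : ℕ)), sv j).re) :
    GqSummable q b a sv s ∧
    Summable (fun p : GIdx a b => GqRepTerm q sv s p.1) ∧
    Gq q b a sv s = ∑' p : GIdx a b, GqRepTerm q sv s p.1 := by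
  obtain ⟨c, rfl⟩ : ∃ c, b = c + 1 := ⟨b - 1, by omega⟩
  have h := convCond_of_re_lt hs hsv
  obtain ⟨h1, h2⟩ := Gq_eq_tsum_gTerm hq0 hq1 c h
  obtain ⟨h3, h4⟩ := summable_GqRepTerm_and_tsum hq0 hq1 c h
  exact ⟨h1, h3, h2.trans h4.symm⟩
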